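/- arXiv:2110.09365 — 2 statements merged into one kernel-verified Lean document; each statement's English description precedes it below -/
import Mathlib

section
/- Let U and B be finite types, α > 0 a real number, and c : U → B → ℝ real coefficients. For θ : B → ℝ and x : U → B → ℝ call (θ, x) feasible if θ b ∈ {0,1} and x u b ∈ {0,1} for all u, b, and x u b ≤ θ b for all u, b. Define θ* b = 1 if α + ∑_{u} min(0, c u b) < 0 and θ* b = 0 otherwise, and define x* u b = 1 if c u b < 0 and θ* b = 1, and x* u b = 0 otherwise. Then (θ*, x*) is feasible and minimizes the objective F(θ, x) = α · ∑_{b} θ b + ∑_{u} ∑_{b} (c u b) · (x u b) over all feasible (θ, x), i.e. F(θ*, x*) ≤ F(θ, x) for every feasible (θ, x). -/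
lemma activation_mul_min_le {t y c : ℝ} (ht : t = 0 ∨ t = 1) (hy : y = 0 ∨ y = 1)
    (hyt : y ≤ t) : t * min 0 c ≤ c * y := by
  rcases ht with rfl | rfl <;> rcases hy with rfl | rfl
  · simp
  · norm_num at hyt
  · simp
  · simp

lemma mul_ite_eq_activation_mul_min {t c : ℝ} (ht : t = 0 ∨ t = 1) :
    c * (if c < 0 ∧ t = 1 then 1 else 0) = t * min 0 c := by
  rcases ht with rfl | rfl
  · simp
  · by_cases hc : c < 0
    · simp [hc, hc.le]
    · simp [hc, not_lt.mp hc]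

lemma objective_eq_sum_columns {U B : Type*} [Fintype U] [Fintype B] (α : ℝ)
    (c : U → B → ℝ) (θ : B → ℝ) (x : U → B → ℝ) :
    α * ∑ b, θ b + ∑ u, ∑ b, c u b * x u b = ∑ b, (α * θ b + ∑ u, c u b * x u b) := by
  rw [Finset.sum_comm, Finset.mul_sum, Finset.sum_add_distrib]


/-- Proposition 1 of the paper: explicit optimal solution of the decoupled binary program
minimize α·∑_b θ_b + ∑_{u,b} c_{u,b} x_{u,b} subject to θ_b, x_{u,b} ∈ {0,1}, x_{u,b} ≤ θ_b. -/
theorem lagrangian_subproblem_optimal_solution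
    {U B : Type*} [Fintype U] [Fintype B] (α : ℝ) (hα : 0 < α) (c : U → B → ℝ)
    (θs : B → ℝ) (xs : U → B → ℝ)
    (hθs : ∀ b, θs b = if α + ∑ u, min 0 (c u b) < 0 then 1 else 0)
    (hxs : ∀ u b, xs u b = if c u b < 0 ∧ θs b = 1 then 1 else 0) :
    ((∀ b, θs b = 0 ∨ θs b = 1) ∧ (∀ u b, xs u b = 0 ∨ xs u b = 1) ∧
      (∀ u b, xs u b ≤ θs b)) ∧
    (∀ θ : B → ℝ, ∀ x : U → B → ℝ,
      ((∀ b, θ b = 0 ∨ θ b = 1) ∧ (∀ u b, x u b = 0 ∨ x u b = 1) ∧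
        (∀ u b, x u b ≤ θ b)) →
      α * ∑ b, θs b + ∑ u, ∑ b, c u b * xs u b ≤
        α * ∑ b, θ b + ∑ u, ∑ b, c u b * x u b) := by
  have hθ01 : ∀ b, θs b = 0 ∨ θs b = 1 := fun b => by
    rw [hθs b]; split_ifs <;> simp
  refine ⟨⟨hθ01, fun u b => ?_, fun u b => ?_⟩, ?_⟩
  · rw [hxs u b]; split_ifs <;> simp
  · rw [hxs u b]
    split_ifs with h
    · exact h.2.ge
    · rcases hθ01 b with h0 | h0 <;> simp [h0]
  · rintro θ x ⟨hθ, hx, hxθ⟩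
    rw [objective_eq_sum_columns, objective_eq_sum_columns]
    refine Finset.sum_le_sum fun b _ => ?_
    calc α * θs b + ∑ u, c u b * xs u b
        = θs b * (α + ∑ u, min 0 (c u b)) := by
          simp_rw [hxs, mul_ite_eq_activation_mul_min (hθ01 b), ← Finset.mul_sum]
          ring
      _ ≤ θ b * (α + ∑ u, min 0 (c u b)) := by
          rw [hθs b]
          split_ifs with h <;> rcases hθ b with h0 | h0 <;> rw [h0] <;> linarith
      _ = α * θ b + ∑ u, θ b * min 0 (c u b) := by
          rw [← Finset.mul_sum]
          ring
      _ ≤ α * θ b + ∑ u, c u b * x u b := by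
          exact add_le_add_right (Finset.sum_le_sum fun u _ =>
            activation_mul_min_le (hθ b) (hx u b) (hxθ u b)) _
end

section
/- Let α be a type with decidable equality, ι a type, F : Finset ι a finite family of candidate sets indexed through A : ι → Finset α, and U : Finset α a finite universe with U.card ≥ 1. Assume there is an optimal cover: a subset C ⊆ F with C.card = k ≥ 1 such that every element of U lies in A i for some i ∈ C. Let s : ℕ → ι be a greedy selection sequence and define the remaining sets recursively by R 0 = U and R (t+1) = R t \ A (s t), and assume the greedy property: for every t, s t ∈ F and (R t ∩ A i).card ≤ (R t ∩ A (s t)).card for all i ∈ F. Then for every natural number T such that R T is nonempty, (T : ℝ) ≤ k · Real.log (U.card). -/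
/-- If `C` covers `V` and `B` meets `V` in at least as many elements as each member of the cover,
then `V` has at most `C.card` times as many elements as `V ∩ B`. -/
theorem Finset.card_le_card_mul_card_inter_of_cover {α ι : Type*} [DecidableEq α]
    {A : ι → Finset α} {V B : Finset α} {C : Finset ι}
    (hcov : ∀ v ∈ V, ∃ i ∈ C, v ∈ A i) (hB : ∀ i ∈ C, (V ∩ A i).card ≤ (V ∩ B).card) :
    V.card ≤ C.card * (V ∩ B).card := by
  have hsub : V ⊆ C.biUnion fun i => V ∩ A i := fun v hv => by
    obtain ⟨i, hi, hvi⟩ := hcov v hv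
    exact Finset.mem_biUnion.2 ⟨i, hi, Finset.mem_inter.2 ⟨hv, hvi⟩⟩
  exact (Finset.card_le_card hsub).trans (Finset.card_biUnion_le_card_mul _ _ _ hB)

/-- Removing a set that meets `V` in at least a `1 / k` fraction of its elements shrinks `V` by a
factor of at least `exp (1 / k)`. -/
theorem Finset.card_sdiff_le_exp_mul_card {α : Type*} [DecidableEq α] {V B : Finset α} {k : ℕ}
    (hk : 0 < k) (h : V.card ≤ k * (V ∩ B).card) :
    ((V \ B).card : ℝ) ≤ Real.exp (-(1 / k)) * V.card := by
  have hk' : (0 : ℝ) < k := by exact_mod_cast hk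
  have hsplit : ((V \ B).card : ℝ) + (V ∩ B).card = V.card := by
    exact_mod_cast Finset.card_sdiff_add_card_inter V B
  have hfrac : (V.card : ℝ) / k ≤ (V ∩ B).card := by
    rw [div_le_iff₀' hk']
    exact_mod_cast h
  calc ((V \ B).card : ℝ) ≤ (-(1 / k) + 1) * V.card := by
        rw [add_mul, neg_mul, one_div_mul_eq_div]
        linarith
    _ ≤ Real.exp (-(1 / k)) * V.card := by
        gcongr
        exact Real.add_one_le_exp _


/-- Core approximation guarantee of the greedy set-cover process (Theorem 2): if an
optimal cover uses k sets, then as long as elements remain uncovered after T greedy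
steps, T ≤ k·log(|U|). -/
theorem greedy_cover_log_approximation
    {α ι : Type*} [DecidableEq α] (F : Finset ι) (A : ι → Finset α)
    (U : Finset α) (hU : 1 ≤ U.card)
    (C : Finset ι) (hCF : C ⊆ F) (k : ℕ) (hk : 1 ≤ k) (hCcard : C.card = k)
    (hcov : ∀ u ∈ U, ∃ i ∈ C, u ∈ A i)
    (s : ℕ → ι) (R : ℕ → Finset α)
    (hR0 : R 0 = U) (hRsucc : ∀ t, R (t + 1) = R t \ A (s t))
    (hsF : ∀ t, s t ∈ F)
    (hgreedy : ∀ t, ∀ i ∈ F, (R t ∩ A i).card ≤ (R t ∩ A (s t)).card) :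
    ∀ T : ℕ, (R T).Nonempty → (T : ℝ) ≤ k * Real.log (U.card) := by
  have hsub : ∀ t, R t ⊆ U := fun t => by
    induction t with
    | zero => exact hR0.subset
    | succ t ih =>
      rw [hRsucc]
      exact Finset.sdiff_subset.trans ih
  have hstep : ∀ t, ((R (t + 1)).card : ℝ) ≤ Real.exp (-(1 / k)) * (R t).card := fun t => by
    rw [hRsucc]
    refine Finset.card_sdiff_le_exp_mul_card hk ?_
    rw [← hCcard]
    exact Finset.card_le_card_mul_card_inter_of_cover (fun u hu => hcov u (hsub t hu))
      fun i hi => hgreedy t i (hCF hi)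
  have hdecay : ∀ t : ℕ, ((R t).card : ℝ) ≤ Real.exp (-(t / k)) * U.card := fun t => by
    induction t with
    | zero => simp [hR0]
    | succ t ih =>
      calc ((R (t + 1)).card : ℝ) ≤ Real.exp (-(1 / k)) * (R t).card := hstep t
        _ ≤ Real.exp (-(1 / k)) * (Real.exp (-(t / k)) * U.card) := by gcongr
        _ = Real.exp (-((t + 1 : ℕ) / k)) * U.card := by
          rw [← mul_assoc, ← Real.exp_add]
          push_cast
          ring_nf
  intro T hT
  have hk' : (0 : ℝ) < k := by exact_mod_cast hk
  have hU' : (0 : ℝ) < U.card := by exact_mod_cast hU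
  have hRT : (1 : ℝ) ≤ (R T).card := by exact_mod_cast hT.card_pos
  have hexp : Real.exp (T / k) ≤ U.card := by
    have h := hRT.trans (hdecay T)
    rwa [Real.exp_neg, inv_mul_eq_div, one_le_div (Real.exp_pos _)] at h
  rw [← div_le_iff₀' hk']
  exact (Real.le_log_iff_exp_le hU').2 hexp
end
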